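/- Let V₅ be a 5-dimensional complex vector space, let θ₁, θ₂, θ₃, θ₄ be alternating bilinear forms on V₅, and let v₁, v₂, v₃ ∈ V₅ be linearly independent vectors such that θᵢ(v₁, v₂) = 0 and θᵢ(v₁, v₃) = 0 for all i = 1,…,4. Then for every v in the span of {v₁, v₂, v₃}, the four linear forms θ₁(v,·), θ₂(v,·), θ₃(v,·), θ₄(v,·) ∈ V₅* are linearly dependent. (Hence the projective plane P(span{v₁,v₂,v₃}) is contained in the Segre cubic C₃ = {[v] : the θᵢ(v,·) are dependent}; this is how each singular point of the fourfold C₄ defines a plane in the Segre cubic primal.) -/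

import Mathlib

theorem dependent_of_common_kernel
    (V : Type*) [AddCommGroup V] [Module ℂ V] (h5 : Module.finrank ℂ V = 5)
    (f : Fin 4 → V →ₗ[ℂ] ℂ) (p q : V) (hpq : LinearIndependent ℂ ![p, q])
    (hp : ∀ i, f i p = 0) (hq : ∀ i, f i q = 0) : ¬ LinearIndependent ℂ f := by
  intro hf
  have : FiniteDimensional ℂ V := Module.finite_of_finrank_pos (by omega)
  have e1 := finrank_span_eq_card hpq
  have e2 := finrank_span_eq_card hf
  have e3 := Subspace.finrank_add_finrank_dualAnnihilator_eq
    (Submodule.span ℂ (Set.range ![p, q]))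
  have hle : Submodule.span ℂ (Set.range f) ≤
      (Submodule.span ℂ (Set.range ![p, q])).dualAnnihilator := by
    rw [Submodule.span_le]
    rintro _ ⟨i, rfl⟩
    rw [SetLike.mem_coe, Submodule.mem_dualAnnihilator]
    intro w hw
    have : Submodule.span ℂ (Set.range ![p, q]) ≤ LinearMap.ker (f i) := by
      rw [Submodule.span_le]
      rintro _ ⟨j, rfl⟩
      fin_cases j
      · simpa using hp i
      · simpa using hq i
    exact this hw
  have e4 := Submodule.finrank_mono hle
  simp only [Fintype.card_fin] at e1 e2
  have e5 : Module.finrank ℂ (Submodule.span ℂ (Set.range f)) ≤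
    Module.finrank ℂ (Submodule.span ℂ (Set.range ![p, q])).dualAnnihilator := e4
  omega

/-- If the four alternating forms `θᵢ` all vanish on `(v₁,v₂)` and `(v₁,v₃)`, then at
every point `v` of the span of `v₁, v₂, v₃` the four linear forms `θᵢ(v,·)` are linearly
dependent: the plane `P(span{v₁,v₂,v₃})` lies on the Segre cubic. -/
theorem plane_in_segre_cubic
    (V₅ : Type*) [AddCommGroup V₅] [Module ℂ V₅] (h5 : Module.finrank ℂ V₅ = 5)
    (θ : Fin 4 → V₅ →ₗ[ℂ] V₅ →ₗ[ℂ] ℂ) (halt : ∀ i, ∀ x, θ i x x = 0)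
    (v₁ v₂ v₃ : V₅) (hind : LinearIndependent ℂ ![v₁, v₂, v₃])
    (h12 : ∀ i, θ i v₁ v₂ = 0) (h13 : ∀ i, θ i v₁ v₃ = 0) :
    ∀ v ∈ Submodule.span ℂ ({v₁, v₂, v₃} : Set V₅),
      ¬ LinearIndependent ℂ (fun i : Fin 4 => θ i v) := by
  intro v hv
  obtain ⟨a, b, c, rfl⟩ := Submodule.mem_span_triple.1 hv
  have hskew : ∀ i x y, θ i x y = - θ i y x := by
    intro i x y
    have h := halt i (x + y)
    simp only [map_add, LinearMap.add_apply, halt, zero_add, add_zero] at h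
    linear_combination h
  have hli : ∀ r s t : ℂ, r • v₁ + s • v₂ + t • v₃ = 0 → r = 0 ∧ s = 0 ∧ t = 0 := by
    intro r s t h
    have h' := Fintype.linearIndependent_iff.1 hind ![r, s, t]
      (by simpa [Fin.sum_univ_three] using h)
    exact ⟨h' 0, h' 1, h' 2⟩
  have k1 : ∀ i, θ i (a • v₁ + b • v₂ + c • v₃) v₁ = 0 := by
    intro i
    simp [halt, hskew i v₂ v₁, hskew i v₃ v₁, h12, h13]
  by_cases hbc : b = 0 ∧ c = 0
  · obtain ⟨rfl, rfl⟩ := hbc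
    refine dependent_of_common_kernel V₅ h5 _ v₁ v₂ ?_ k1 (fun i => by simp [h12])
    rw [LinearIndependent.pair_iff]
    intro s t h
    have := hli s t 0 (by simpa using h)
    exact ⟨this.1, this.2.1⟩
  · refine dependent_of_common_kernel V₅ h5 _ v₁ (a • v₁ + b • v₂ + c • v₃) ?_ k1
      (fun i => halt i _)
    rw [LinearIndependent.pair_iff]
    intro s t h
    obtain ⟨h1, h2, h3⟩ := hli (s + t * a) (t * b) (t * c) (by rw [← h]; module)
    have ht : t = 0 := by
      by_contra ht
      exact hbc ⟨(mul_eq_zero.1 h2).resolve_left ht, (mul_eq_zero.1 h3).resolve_left ht⟩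
    subst ht
    exact ⟨by simpa using h1, rfl⟩
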